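/- (One-step constraint violation recursion.) Let h_t, h_{t+1}: ℝ^m → ℝ^S be such that every component of h_t is convex and sup_{x∈X} ‖h_{t+1}(x) − h_t(x)‖ ≤ γ, let δ ∈ (0,1), let x ∈ X and x̃ ∈ X satisfy h_t(x̃) ≤ 0 componentwise, and set x⁺ := x + δ(x̃ − x). If x⁺ ∈ X, then componentwise [h_{t+1}(x⁺)]⁺ ≤ (1 − δ)·[h_t(x)]⁺ + γ·1_S, where [·]⁺ denotes the componentwise positive part max{0,·} and 1_S is the all-ones vector in ℝ^S. -/

import Mathlib

noncomputable section

/-- **One-step constraint violation recursion**: if every component of h_t is convex,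
‖h_{t+1}(z) − h_t(z)‖ ≤ γ on X, h_t(x̃) ≤ 0 componentwise, and x⁺ = x + δ(x̃ − x) ∈ X with
δ ∈ (0,1), then componentwise [h_{t+1}(x⁺)]⁺ ≤ (1−δ)[h_t(x)]⁺ + γ·1_S. -/
theorem one_step_constraint_violation_recursion
    (m S : ℕ) (X : Set (EuclideanSpace ℝ (Fin m))) (hXconv : Convex ℝ X)
    (h h' : EuclideanSpace ℝ (Fin m) → EuclideanSpace ℝ (Fin S))
    (γ δ : ℝ) (hγ : 0 ≤ γ) (hδ0 : 0 < δ) (hδ1 : δ < 1)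
    (hconv : ∀ k, ConvexOn ℝ Set.univ (fun z => h z k))
    (hvar : ∀ z ∈ X, ‖h' z - h z‖ ≤ γ)
    (x xt : EuclideanSpace ℝ (Fin m)) (hx : x ∈ X) (hxt : xt ∈ X)
    (hfeas : ∀ k, h xt k ≤ 0)
    (xplus : EuclideanSpace ℝ (Fin m)) (hplus : xplus = x + δ • (xt - x))
    (hplusX : xplus ∈ X) :
    ∀ k, max (h' xplus k) 0 ≤ (1 - δ) * max (h x k) 0 + γ := by
  intro k
  have hdiff : h' xplus k - h xplus k ≤ γ :=
    (le_abs_self _).trans ((PiLp.norm_apply_le (h' xplus - h xplus) k).trans (hvar xplus hplusX))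
  have hcomb : xplus = (1 - δ) • x + δ • xt := by
    rw [hplus]
    module
  have hjensen : h xplus k ≤ (1 - δ) * h x k + δ * h xt k := by
    rw [hcomb]
    exact (hconv k).2 (Set.mem_univ x) (Set.mem_univ xt) (sub_nonneg.2 hδ1.le) hδ0.le
      (sub_add_cancel 1 δ)
  have hxt_le : δ * h xt k ≤ 0 := mul_nonpos_of_nonneg_of_nonpos hδ0.le (hfeas k)
  have hx_le : (1 - δ) * h x k ≤ (1 - δ) * max (h x k) 0 :=
    mul_le_mul_of_nonneg_left (le_max_left _ _) (sub_nonneg.2 hδ1.le)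
  have hpos : 0 ≤ (1 - δ) * max (h x k) 0 :=
    mul_nonneg (sub_nonneg.2 hδ1.le) (le_max_right _ _)
  exact max_le (by linarith) (by linarith)

end
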